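/- Let 𝒜 = a₁₂e₁₂ + a₁₃e₁₃ + a₂₃e₂₃ be a nonzero bivector in Cl(3,0) and write ‖𝒜‖ = √(a₁₂² + a₁₃² + a₂₃²). Then for any integers c₁, c₂, exp( (1/2)·log(‖𝒜‖²) - π(1/2 + 2c₂)·(𝒜/‖𝒜‖) + π(1 + 2c₁)·I ) = 𝒜. -/

import Mathlib

open Real CliffordAlgebra

noncomputable section

/-- The quadratic form of signature (3,0): `Q(x) = x₁² + x₂² + x₃²`. -/
def Q30 : QuadraticForm ℝ (Fin 3 → ℝ) := QuadraticMap.weightedSumSquares ℝ ![1, 1, 1]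

/-- The real Clifford algebra Cl(3,0). -/
abbrev Cl30 := CliffordAlgebra Q30

/-- The canonical (module) topology on the finite-dimensional real algebra Cl(3,0). -/
instance : TopologicalSpace Cl30 := moduleTopology ℝ Cl30

/-- The orthonormal generators `e₁, e₂, e₃` (indexed here by `0, 1, 2`). -/
def e (i : Fin 3) : Cl30 := ι Q30 (Pi.single i 1)

/-- The pseudoscalar `I = e₁e₂e₃`. -/
def I3 : Cl30 := e 0 * e 1 * e 2

/-- The exponential `exp M = ∑ₖ Mᵏ/k!` in Cl(3,0). -/
def expCl (M : Cl30) : Cl30 := ∑' n : ℕ, (n.factorial : ℝ)⁻¹ • M ^ n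

/-- `atan2 y x` is the argument in `(-π, π]` of the complex number `x + iy`. -/
def atan2 (y x : ℝ) : ℝ := Complex.arg ⟨x, y⟩

theorem e_mul_self (i : Fin 3) : e i * e i = 1 := by
  have h : Q30 (Pi.single i 1) = 1 := by
    fin_cases i <;> simp [Q30, QuadraticMap.weightedSumSquares_apply, Fin.sum_univ_three]
  rw [e, ι_sq_scalar, h, map_one]

theorem e_mul_swap {i j : Fin 3} (hij : i ≠ j) : e j * e i = -(e i * e j) := by
  have h : QuadraticMap.IsOrtho Q30 (Pi.single j 1) (Pi.single i 1) := by
    rw [QuadraticMap.isOrtho_def]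
    fin_cases i <;> fin_cases j <;>
      simp [Q30, QuadraticMap.weightedSumSquares_apply, Fin.sum_univ_three] at hij ⊢
  exact ι_mul_ι_comm_of_isOrtho h

theorem e_mul_self_mul (i : Fin 3) (x : Cl30) : e i * (e i * x) = x := by
  rw [← mul_assoc, e_mul_self, one_mul]

theorem e_mul_swap_mul {i j : Fin 3} (hij : i ≠ j) (x : Cl30) :
    e j * (e i * x) = -(e i * (e j * x)) := by
  rw [← mul_assoc, e_mul_swap hij, neg_mul, mul_assoc]

theorem I3_mul_self : I3 * I3 = -1 := by
  have h01 : (0 : Fin 3) ≠ 1 := by decide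
  have h02 : (0 : Fin 3) ≠ 2 := by decide
  have h12 : (1 : Fin 3) ≠ 2 := by decide
  simp only [I3, mul_assoc, e_mul_self, e_mul_swap_mul h01, e_mul_swap_mul h02, e_mul_swap_mul h12,
    mul_neg, neg_neg, mul_one]

theorem commute_I3_bivector (a b c : ℝ) :
    Commute I3 (a • (e 0 * e 1) + b • (e 0 * e 2) + c • (e 1 * e 2)) := by
  have h01 : (0 : Fin 3) ≠ 1 := by decide
  have h02 : (0 : Fin 3) ≠ 2 := by decide
  have h12 : (1 : Fin 3) ≠ 2 := by decide
  simp only [Commute, SemiconjBy, I3, mul_add, add_mul, mul_smul_comm, smul_mul_assoc, mul_assoc,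
    e_mul_self, e_mul_self_mul, e_mul_swap h01,
    e_mul_swap h12, e_mul_swap_mul h01, e_mul_swap_mul h02, e_mul_swap_mul h12, mul_neg, neg_neg,
    mul_one]

theorem bivector_mul_self (a b c : ℝ) :
    (a • (e 0 * e 1) + b • (e 0 * e 2) + c • (e 1 * e 2)) *
      (a • (e 0 * e 1) + b • (e 0 * e 2) + c • (e 1 * e 2)) =
      -((a ^ 2 + b ^ 2 + c ^ 2) • (1 : Cl30)) := by
  have h01 : (0 : Fin 3) ≠ 1 := by decide
  have h02 : (0 : Fin 3) ≠ 2 := by decide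
  have h12 : (1 : Fin 3) ≠ 2 := by decide
  simp only [mul_add, add_mul, mul_smul_comm, smul_mul_assoc, mul_assoc,
    e_mul_self, e_mul_self_mul, e_mul_swap h01,
    e_mul_swap h12, e_mul_swap_mul h01, e_mul_swap_mul h02, e_mul_swap_mul h12, mul_neg, neg_neg,
    mul_one]
  module

instance : IsModuleTopology ℝ Cl30 := ⟨rfl⟩

/-- Linear functionals are continuous for the module topology and separate points. -/
theorem t2Space_of_isModuleTopology (V : Type*) [AddCommGroup V] [Module ℝ V]
    [TopologicalSpace V] [IsModuleTopology ℝ V] : T2Space V := by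
  refine ⟨fun x y hxy => ?_⟩
  obtain ⟨f, hf⟩ : ∃ f : Module.Dual ℝ V, f (x - y) ≠ 0 := by
    by_contra! h
    exact hxy (sub_eq_zero.1 ((Module.forall_dual_apply_eq_zero_iff ℝ _).1 h))
  rw [map_sub, sub_ne_zero] at hf
  exact separated_by_continuous (IsModuleTopology.continuous_of_linearMap f) hf

theorem add_pow_of_orthogonal_idempotents {A : Type*} [Ring A] {x y p q : A}
    (hpq : p + q = 1) (hp : p * p = p) (hxp : Commute x p) (hyp : Commute y p) (n : ℕ) :
    (x * p + y * q) ^ n = x ^ n * p + y ^ n * q := by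
  obtain rfl : q = 1 - p := eq_sub_of_add_eq' hpq
  induction n with
  | zero => simp
  | succ n ih =>
    have hq : (1 - p) * (1 - p) = 1 - p := by simp [mul_sub, sub_mul, hp]
    have hpq' : p * (1 - p) = 0 := by simp [mul_sub, hp]
    have hqp : (1 - p) * p = 0 := by simp [sub_mul, hp]
    have hyq : Commute y (1 - p) := (Commute.one_right y).sub_right hyp
    have hxq : Commute x (1 - p) := (Commute.one_right x).sub_right hxp
    have h1 : x ^ n * p * (x * p) = x ^ (n + 1) * p := by
      rw [pow_succ, mul_assoc, ← mul_assoc p, ← hxp.eq, mul_assoc x, hp, mul_assoc]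
    have h2 : x ^ n * p * (y * (1 - p)) = 0 := by
      rw [mul_assoc, ← mul_assoc p, ← hyp.eq, mul_assoc y, hpq', mul_zero, mul_zero]
    have h3 : y ^ n * (1 - p) * (x * p) = 0 := by
      rw [mul_assoc, ← mul_assoc (1 - p), ← hxq.eq, mul_assoc x, hqp, mul_zero, mul_zero]
    have h4 : y ^ n * (1 - p) * (y * (1 - p)) = y ^ (n + 1) * (1 - p) := by
      rw [pow_succ, mul_assoc, ← mul_assoc (1 - p), ← hyq.eq, mul_assoc y, hq, mul_assoc]
    rw [pow_succ, ih, add_mul, mul_add, mul_add, h1, h2, h3, h4, add_zero, zero_add]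

/-- The exponential on the image of `ℂ × ℂ` in `Cl30` given by a complex structure and a
commuting idempotent. -/
theorem expCl_of_orthogonal_idempotents (f : ℂ →ₐ[ℝ] Cl30) {p q : Cl30} (hpq : p + q = 1)
    (hp : p * p = p) (hf : ∀ z, Commute (f z) p) (z w : ℂ) :
    expCl (f z * p + f w * q) = f (Complex.exp z) * p + f (Complex.exp w) * q := by
  have := t2Space_of_isModuleTopology Cl30
  have : IsTopologicalAddGroup Cl30 := IsModuleTopology.topologicalAddGroup ℝ Cl30
  have : ContinuousSMul ℝ Cl30 := IsModuleTopology.toContinuousSMul ℝ Cl30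
  have key (r : Cl30) (u : ℂ) : HasSum (fun n : ℕ => (n.factorial : ℝ)⁻¹ • (f u ^ n * r))
      (f (Complex.exp u) * r) := by
    let g : ℂ →ₗ[ℝ] Cl30 := LinearMap.mulRight ℝ r ∘ₗ f.toLinearMap
    have hs : HasSum (fun n : ℕ => (n.factorial : ℝ)⁻¹ • u ^ n) (Complex.exp u) := by
      rw [Complex.exp_eq_exp_ℂ]
      exact NormedSpace.exp_series_hasSum_exp' (𝕂 := ℝ) u
    convert hs.map g g.continuous_of_finiteDimensional using 1
    · ext n
      rw [Function.comp_apply, map_smul]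
      simp [g]
    · simp [g]
  refine HasSum.tsum_eq ?_
  simpa only [add_pow_of_orthogonal_idempotents hpq hp (hf z) (hf w), smul_add]
    using (key p z).add (key q w)

/-- If `I`, `J` are commuting square roots of `-1`, then
`exp (l - θ J + ψ I)` splits along the idempotents `(1 ± I J) / 2`. -/
theorem expCl_of_commuting_sqrt_neg_one {J : Cl30} (hJ : J * J = -1) (hIJ : Commute I3 J)
    {l θ ψ n : ℝ} (hz : Complex.exp (l + (θ + ψ) * Complex.I) = -(n * Complex.I))
    (hw : Complex.exp (l + (ψ - θ) * Complex.I) = n * Complex.I) :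
    expCl (algebraMap ℝ Cl30 l - θ • J + ψ • I3) = n • J := by
  let f : ℂ →ₐ[ℝ] Cl30 := Complex.lift ⟨I3, I3_mul_self⟩
  have hfa (a b : ℝ) : f (a + b * Complex.I) = algebraMap ℝ Cl30 a + b • I3 := by
    simp [f, Complex.liftAux_apply]
  have hIK : I3 * (I3 * J) = -J := by rw [← mul_assoc, I3_mul_self, neg_one_mul]
  have hKK : I3 * J * (I3 * J) = 1 := by
    rw [mul_assoc, ← mul_assoc J, ← hIJ.eq, mul_assoc I3 J J, hJ, mul_neg_one, mul_neg,
      I3_mul_self, neg_neg]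
  have hIK' : Commute I3 (I3 * J) := (Commute.refl _).mul_right hIJ
  have h := expCl_of_orthogonal_idempotents f (p := (1 / 2 : ℝ) • (1 + I3 * J))
    (q := (1 / 2 : ℝ) • (1 - I3 * J)) (by module)
    (by
      simp only [smul_mul_smul_comm, mul_add, add_mul, one_mul, mul_one, hKK]
      module)
    (fun z => by
      rw [← Complex.re_add_im z, hfa]
      exact (Algebra.commute_algebraMap_left _ _).add_left
        ((((Commute.one_right I3).add_right hIK').smul_right _).smul_left _))
    (l + (θ + ψ) * Complex.I) (l + (ψ - θ) * Complex.I)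
  rw [hz, hw] at h
  have h1 := hfa l (θ + ψ)
  have h2 := hfa l (ψ - θ)
  have h3 : f (n * Complex.I) = n • I3 := by simpa using hfa 0 n
  push_cast at h1 h2
  rw [map_neg, h1, h2, h3] at h
  simp only [Algebra.algebraMap_eq_smul_one, add_mul, smul_mul_assoc, mul_smul_comm, neg_mul,
    mul_add, mul_sub, one_mul, mul_one, hIK] at h
  rw [Algebra.algebraMap_eq_smul_one]
  convert h using 1
  · congr 1
    module
  · module

/-- exponential of the logarithm of a nonzero bivector in Cl(3,0). -/
theorem exp_log_bivector_Cl30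
    (a12 a13 a23 n : ℝ) (c1 c2 : ℤ) (bA : Cl30)
    (hbA : bA = a12 • (e 0 * e 1) + a13 • (e 0 * e 2) + a23 • (e 1 * e 2))
    (hn : n = Real.sqrt (a12 ^ 2 + a13 ^ 2 + a23 ^ 2))
    (hnpos : 0 < n) :
    expCl (algebraMap ℝ Cl30 ((1 / 2) * Real.log (n ^ 2)) -
      (π * (1 / 2 + 2 * c2) / n) • bA + (π * (1 + 2 * c1)) • I3) = bA := by
  have hn2 : n ^ 2 = a12 ^ 2 + a13 ^ 2 + a23 ^ 2 := by rw [hn, Real.sq_sqrt (by positivity)]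
  have hJ : (n⁻¹ • bA) * (n⁻¹ • bA) = -1 := by
    rw [smul_mul_smul_comm, hbA, bivector_mul_self, ← hn2, smul_neg, smul_smul]
    field_simp
    simp
  have hIJ : Commute I3 (n⁻¹ • bA) := by
    rw [hbA]
    exact (commute_I3_bivector a12 a13 a23).smul_right _
  have hl : (1 / 2) * Real.log (n ^ 2) = Real.log n := by
    rw [Real.log_pow]
    push_cast
    ring
  have hexp : Complex.exp (Real.log n : ℝ) = n := by
    rw [← Complex.ofReal_exp, Real.exp_log hnpos]
  have h := expCl_of_commuting_sqrt_neg_one hJ hIJ (l := Real.log n)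
    (θ := π * (1 / 2 + 2 * c2)) (ψ := π * (1 + 2 * c1)) (n := n)
    (by
      rw [Complex.exp_add, hexp, show ((π * (1 / 2 + 2 * c2) : ℝ) + (π * (1 + 2 * c1) : ℝ) : ℂ)
        * Complex.I = π * Complex.I + π / 2 * Complex.I + (c1 + c2 : ℤ) * (2 * π * Complex.I) by
          push_cast; ring, Complex.exp_add, Complex.exp_add, Complex.exp_int_mul_two_pi_mul_I,
        Complex.exp_pi_mul_I, Complex.exp_pi_div_two_mul_I]
      ring)
    (by
      rw [Complex.exp_add, hexp, show ((π * (1 + 2 * c1) : ℝ) - (π * (1 / 2 + 2 * c2) : ℝ) : ℂ)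
        * Complex.I = π / 2 * Complex.I + (c1 - c2 : ℤ) * (2 * π * Complex.I) by
          push_cast; ring, Complex.exp_add, Complex.exp_int_mul_two_pi_mul_I,
        Complex.exp_pi_div_two_mul_I, mul_one])
  rw [smul_smul, smul_smul, mul_inv_cancel₀ hnpos.ne', one_smul, ← div_eq_mul_inv] at h
  rw [hl, h]
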